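/- arXiv:1307.6842 — 2 statements merged into one kernel-verified Lean document; each statement's English description precedes it below -/
import Mathlib

section
/- Let α₀ < α₁ < … < αₙ be natural numbers, let σ₀, σ₁, …, σₙ ∈ {+1, −1} be prescribed signs, and let k be the number of indices i with σᵢ = −σᵢ₊₁. Let S be any multiset of positive real numbers of cardinality p such that k − p is even and nonnegative. Then there exist nonzero real numbers a₀, …, aₙ with sign(aᵢ) = σᵢ for all i such that the polynomial p(x) = a₀x^{α₀} + a₁x^{α₁} + … + aₙx^{αₙ} has S as its multiset of positive real roots counted with multiplicity. -/
open Polynomial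

/-- Descartes' rule only sees the support: a polynomial with `m` terms has at most `m - 1`
sign variations. -/
theorem signVariations_lt_card_support {P : ℝ[X]} (hP : P ≠ 0) :
    P.signVariations < P.support.card := by
  induction h : P.support.card using Nat.strong_induction_on generalizing P with
  | _ m ih =>
    have hlt := eraseLead_support_card_lt hP
    have hle := signVariations_le_eraseLead_succ (P := P)
    by_cases h0 : P.eraseLead = 0
    · rw [h0, signVariations_zero] at hle
      have hadd := signVariations_eq_eraseLead_add_ite hP
      have hsupp : P.support.card ≠ 0 := by simpa using hP
      have hmono : P = monomial P.natDegree P.leadingCoeff := by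
        conv_lhs => rw [← eraseLead_add_monomial_natDegree_leadingCoeff P, h0, zero_add]
      rw [hmono, signVariations_monomial]
      omega
    · have := ih _ (h ▸ hlt) h0 rfl
      omega

/-- A real polynomial with positive leading coefficient and no positive root is positive on
`(0, ∞)`. -/
theorem eval_pos_of_no_pos_root {g : ℝ[X]} (hlead : 0 < g.leadingCoeff)
    (hroot : ∀ x : ℝ, 0 < x → g.eval x ≠ 0) {x : ℝ} (hx : 0 < x) : 0 < g.eval x := by
  by_contra! hneg
  obtain ⟨y, hxy, hy⟩ : ∃ y, x ≤ y ∧ 0 ≤ g.eval y := by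
    by_cases hdeg : 0 < g.degree
    · have := g.tendsto_atTop_of_leadingCoeff_nonneg hdeg hlead.le
      exact ((Filter.eventually_ge_atTop x).and (this.eventually_ge_atTop 0)).exists
    · rw [eq_C_of_degree_le_zero (not_lt.mp hdeg)] at hlead ⊢
      exact ⟨x, le_rfl, by simpa using hlead.le⟩
  obtain ⟨z, hz, hz0⟩ := intermediate_value_Icc hxy g.continuous.continuousOn ⟨hneg, hy⟩
  exact hroot z (hx.trans_le hz.1) hz0

theorem roots_filter_pos_prod_mul {S : Multiset ℝ} (hS : ∀ x ∈ S, 0 < x) {g : ℝ[X]}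
    (hg : ∀ x : ℝ, 0 < x → g.eval x ≠ 0) :
    ((S.map fun s => X - C s).prod * g).roots.filter (fun x => 0 < x) = S := by
  have hg0 : g ≠ 0 := by
    rintro rfl
    exact hg 1 one_pos eval_zero
  have hD : (S.map fun s => X - C s).prod ≠ 0 :=
    (monic_multiset_prod_of_monic S _ fun s _ => monic_X_sub_C s).ne_zero
  rw [roots_mul (mul_ne_zero hD hg0), roots_multiset_prod_X_sub_C, Multiset.filter_add,
    Multiset.filter_eq_self.2 hS, Multiset.filter_eq_nil.2, add_zero]
  intro x hx hx0
  exact hg x hx0 (isRoot_of_mem_roots hx)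

/-- If a polynomial with at most `card S + 1` terms and positive leading coefficient vanishes on the
multiset `S` of positive reals, then the cofactor is positive on `(0, ∞)`. -/
theorem eval_cofactor_pos {S : Multiset ℝ} (hS : ∀ x ∈ S, 0 < x) {g : ℝ[X]}
    (hcard : ((S.map fun s => X - C s).prod * g).support.card ≤ Multiset.card S + 1)
    (hlead : 0 < ((S.map fun s => X - C s).prod * g).leadingCoeff) {x : ℝ} (hx : 0 < x) :
    0 < g.eval x := by
  have hD : (S.map fun s => X - C s).prod.Monic :=
    monic_multiset_prod_of_monic S _ fun s _ => monic_X_sub_C s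
  have hf : (S.map fun s => X - C s).prod * g ≠ 0 := leadingCoeff_ne_zero.1 hlead.ne'
  rw [leadingCoeff_mul, Monic.leadingCoeff hD, one_mul] at hlead
  refine eval_pos_of_no_pos_root hlead (fun y hy hy0 => ?_) hx
  have hcount := roots_countP_pos_le_signVariations (P := (S.map fun s => X - C s).prod * g)
  have hvar := signVariations_lt_card_support hf
  rw [roots_mul hf, roots_multiset_prod_X_sub_C, Multiset.countP_add,
    Multiset.countP_eq_card.2 hS] at hcount
  have : 0 < g.roots.countP (0 < ·) :=
    Multiset.countP_pos.2 ⟨y, (mem_roots (right_ne_zero_of_mul hf)).2 hy0, hy⟩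
  omega

theorem leadingCoeff_sum_monomials {p : ℕ} {e : Fin (p + 1) → ℕ} (he : StrictMono e)
    {b : Fin (p + 1) → ℝ} (hb : b (Fin.last p) ≠ 0) :
    (∑ i, C (b i) * X ^ e i).leadingCoeff = b (Fin.last p) := by
  rw [Fin.sum_univ_castSucc, leadingCoeff_add_of_degree_lt, leadingCoeff_C_mul_X_pow]
  rw [degree_C_mul_X_pow _ hb]
  refine (degree_sum_le _ _).trans_lt ((Finset.sup_lt_iff (WithBot.bot_lt_coe _)).2 fun i _ => ?_)
  exact (degree_C_mul_X_pow_le _ _).trans_lt (WithBot.coe_lt_coe.2 (he (Fin.castSucc_lt_last i)))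

theorem card_support_sum_monomials_le {ι : Type*} [Fintype ι] (e : ι → ℕ) (b : ι → ℝ) :
    (∑ i, C (b i) * X ^ e i).support.card ≤ Fintype.card ι := by
  classical
  refine (Finset.card_le_card (t := Finset.univ.image e) fun m hm => ?_).trans Finset.card_image_le
  by_contra hne
  refine mem_support_iff.1 hm ?_
  rw [finsetSum_coeff]
  refine Finset.sum_eq_zero fun i _ => ?_
  rw [coeff_C_mul_X_pow, if_neg]
  rintro rfl
  exact hne (Finset.mem_image_of_mem e (Finset.mem_univ i))

/-- The alternating case: `p + 1` exponents and `p` prescribed positive roots. -/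
theorem exists_alternating_coeffs (p : ℕ) (e : Fin (p + 1) → ℕ) (he : StrictMono e)
    (S : Multiset ℝ) (hS : ∀ x ∈ S, 0 < x) (hp : Multiset.card S = p) :
    ∃ (b : Fin (p + 1) → ℝ) (g : ℝ[X]),
      (∀ i : Fin (p + 1), 0 < (-1) ^ (p + (i : ℕ)) * b i) ∧
      ∑ i, C (b i) * X ^ e i = (S.map fun s => X - C s).prod * g ∧
      ∀ x : ℝ, 0 < x → 0 < g.eval x := by
  induction p generalizing S with
  | zero =>
    obtain rfl := Multiset.card_eq_zero.1 hp
    exact ⟨fun _ => 1, X ^ e 0, by simp, by simp, fun x hx => by simpa using pow_pos hx _⟩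
  | succ p ih =>
    obtain ⟨s, hsS⟩ : ∃ s, s ∈ S := Multiset.card_pos_iff_exists_mem.1 (by omega)
    obtain ⟨T, rfl⟩ := Multiset.exists_cons_of_mem hsS
    have hT : Multiset.card T = p := by simpa using hp
    have hTpos : ∀ x ∈ T, 0 < x := fun x hx => hS x (Multiset.mem_cons_of_mem hx)
    have hs : 0 < s := hS s (Multiset.mem_cons_self s T)
    obtain ⟨b₁, g₁, hb₁, hf₁, hg₁⟩ :=
      ih (fun i => e i.castSucc) (he.comp (Fin.strictMono_castSucc)) T hTpos hT
    obtain ⟨b₂, g₂, hb₂, hf₂, hg₂⟩ :=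
      ih (fun i => e i.succ) (he.comp (Fin.strictMono_succ)) T hTpos hT
    set c := g₂.eval s / g₁.eval s with hc
    have hcpos : 0 < c := div_pos (hg₂ s hs) (hg₁ s hs)
    obtain ⟨g, hg⟩ : X - C s ∣ g₂ - C c * g₁ := by
      rw [dvd_iff_isRoot]
      simp [IsRoot, hc, (hg₁ s hs).ne']
    let b : Fin (p + 2) → ℝ := fun i =>
      Fin.cons (α := fun _ => ℝ) 0 b₂ i - c * Fin.snoc (α := fun _ => ℝ) b₁ 0 i
    have hsum : ∑ i, C (b i) * X ^ e i = ((s ::ₘ T).map fun s => X - C s).prod * g := by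
      have h₂ : ∑ i, C (Fin.cons (α := fun _ => ℝ) 0 b₂ i : ℝ) * X ^ e i =
          (T.map fun s => X - C s).prod * g₂ := by
        rw [Fin.sum_univ_succ, ← hf₂]
        simp
      have h₁ : ∑ i, C (Fin.snoc (α := fun _ => ℝ) b₁ 0 i : ℝ) * X ^ e i =
          (T.map fun s => X - C s).prod * g₁ := by
        rw [Fin.sum_univ_castSucc, ← hf₁]
        simp
      calc ∑ i, C (b i) * X ^ e i
          = (T.map fun s => X - C s).prod * g₂ - C c * ((T.map fun s => X - C s).prod * g₁) := by
            rw [← h₁, ← h₂, Finset.mul_sum, ← Finset.sum_sub_distrib]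
            refine Finset.sum_congr rfl fun i _ => ?_
            simp only [b, C_sub, C_mul]
            ring
        _ = (T.map fun s => X - C s).prod * (g₂ - C c * g₁) := by ring
        _ = _ := by
          rw [hg, Multiset.map_cons, Multiset.prod_cons]
          ring
    have hb : ∀ i : Fin (p + 2), 0 < (-1) ^ (p + 1 + (i : ℕ)) * b i := by
      have hcons : ∀ i : Fin (p + 1), 0 < (-1) ^ (p + 1 + (i.succ : ℕ)) * b₂ i := fun i => by
        have := hb₂ i
        rw [Fin.val_succ, show p + 1 + ((i : ℕ) + 1) = p + i + 2 by ring, pow_add]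
        linarith
      have hsnoc : ∀ i : Fin (p + 1), (-1) ^ (p + 1 + (i.castSucc : ℕ)) * (c * b₁ i) < 0 :=
        fun i => by
          have := mul_pos hcpos (hb₁ i)
          rw [Fin.val_castSucc, show p + 1 + (i : ℕ) = p + i + 1 by ring, pow_succ]
          linarith
      have hcons' : ∀ i : Fin (p + 2),
          0 ≤ (-1) ^ (p + 1 + (i : ℕ)) * Fin.cons (α := fun _ => ℝ) 0 b₂ i := fun i => by
        cases i using Fin.cases with
        | zero => simp
        | succ i => simpa using (hcons i).le
      have hsnoc' : ∀ i : Fin (p + 2),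
          (-1) ^ (p + 1 + (i : ℕ)) * (c * Fin.snoc (α := fun _ => ℝ) b₁ 0 i) ≤ 0 := fun i => by
        cases i using Fin.lastCases with
        | last => simp
        | cast i => simpa using (hsnoc i).le
      intro i
      simp only [b, mul_sub]
      cases i using Fin.cases with
      | zero =>
        have h₁ := hsnoc 0
        have h₂ := hcons' 0
        have h₃ : Fin.snoc (α := fun _ => ℝ) b₁ 0 (0 : Fin (p + 2)) = b₁ 0 :=
          Fin.snoc_castSucc (α := fun _ => ℝ) 0 b₁ 0
        rw [h₃]
        rw [Fin.castSucc_zero] at h₁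
        linarith
      | succ i =>
        have h₁ := hsnoc' i.succ
        have h₂ := hcons i
        rw [Fin.cons_succ]
        linarith
    refine ⟨b, g, hb, hsum, fun x hx => ?_⟩
    have hlast : 0 < b (Fin.last (p + 1)) := by
      have := hb (Fin.last (p + 1))
      rwa [Fin.val_last, Even.neg_one_pow ⟨p + 1, rfl⟩, one_mul] at this
    refine eval_cofactor_pos hS ?_ ?_ hx
    · rw [← hsum, hp]
      simpa using card_support_sum_monomials_le e b
    · rw [← hsum, leadingCoeff_sum_monomials he hlast.ne']
      exact hlast

/-- The number of sign variations strictly before position `i`. -/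
noncomputable def variationsBefore {n : ℕ} (σ : Fin (n + 1) → ℝ) (i : Fin (n + 1)) : ℕ :=
  Nat.card {l : Fin n // l.castSucc < i ∧ σ l.castSucc = -σ l.succ}

theorem variationsBefore_zero {n : ℕ} (σ : Fin (n + 1) → ℝ) : variationsBefore σ 0 = 0 := by
  simp [variationsBefore]

theorem variationsBefore_succ {n : ℕ} (σ : Fin (n + 1) → ℝ) (i : Fin n)
    [Decidable (σ i.castSucc = -σ i.succ)] :
    variationsBefore σ i.succ =
      variationsBefore σ i.castSucc + if σ i.castSucc = -σ i.succ then 1 else 0 := by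
  classical
  simp only [variationsBefore, Nat.card_eq_fintype_card, Fintype.card_subtype]
  split_ifs with h
  · rw [← Finset.card_insert_of_notMem (a := i) (by simp)]
    congr 1
    ext l
    simp only [Finset.mem_filter, Finset.mem_univ, true_and, Finset.mem_insert,
      Fin.castSucc_lt_succ_iff, Fin.castSucc_lt_castSucc_iff, le_iff_lt_or_eq]
    constructor
    · rintro ⟨h1 | h1, h2⟩
      · exact Or.inr ⟨h1, h2⟩
      · exact Or.inl h1
    · rintro (rfl | ⟨h1, h2⟩)
      · exact ⟨Or.inr rfl, h⟩
      · exact ⟨Or.inl h1, h2⟩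
  · rw [add_zero]
    congr 1
    ext l
    simp only [Finset.mem_filter, Finset.mem_univ, true_and,
      Fin.castSucc_lt_succ_iff, Fin.castSucc_lt_castSucc_iff, le_iff_lt_or_eq]
    constructor
    · rintro ⟨h1 | rfl, h2⟩
      · exact ⟨h1, h2⟩
      · exact absurd h2 h
    · rintro ⟨h1, h2⟩
      exact ⟨Or.inl h1, h2⟩

theorem variationsBefore_mono {n : ℕ} (σ : Fin (n + 1) → ℝ) : Monotone (variationsBefore σ) := by
  classical
  refine Fin.monotone_iff_le_succ.2 fun i => ?_
  rw [variationsBefore_succ]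
  exact Nat.le_add_right _ _

theorem sign_eq_neg_one_pow_variationsBefore {n : ℕ} {σ : Fin (n + 1) → ℝ}
    (hσ : ∀ i, σ i = 1 ∨ σ i = -1) (i : Fin (n + 1)) :
    σ i = (-1) ^ variationsBefore σ i * σ 0 := by
  classical
  induction i using Fin.induction with
  | zero => simp [variationsBefore_zero]
  | succ i ih =>
    rw [variationsBefore_succ]
    split_ifs with h
    · rw [pow_succ]
      linarith
    · rw [add_zero, ← ih]
      rcases hσ i.succ with h1 | h1 <;> rcases hσ i.castSucc with h2 | h2 <;> rw [h1, h2] at h ⊢ <;>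
        norm_num at h

theorem exists_variationsBefore_eq {n : ℕ} (σ : Fin (n + 1) → ℝ) (i : Fin (n + 1)) {m : ℕ}
    (hm : m ≤ variationsBefore σ i) : ∃ l, variationsBefore σ l = m := by
  classical
  induction i using Fin.induction with
  | zero => exact ⟨0, by rw [variationsBefore_zero] at *; omega⟩
  | succ i ih =>
    rcases hm.eq_or_lt with h | h
    · exact ⟨_, h.symm⟩
    · refine ih ?_
      rw [variationsBefore_succ] at h
      split_ifs at h <;> omega

/-- An increasing selection of `p + 1` of the numbers `0, …, k`, of alternating parity and starting
with an even one, can be made to contain any prescribed `m`. -/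
theorem exists_alternating_selection {p k m : ℕ} (hp : 0 < p) (hpk : p ≤ k)
    (hparity : Even (k - p)) (hm : m ≤ k) :
    ∃ d : Fin (p + 1) → ℕ, StrictMono d ∧ (∀ i, d i ≤ k) ∧ (∀ i, Even (d i + i)) ∧
      ∃ i, d i = m := by
  obtain ⟨q, hq⟩ := hparity
  obtain ⟨t, htp, htm, htk, r, hr⟩ :
      ∃ t, t ≤ p ∧ t ≤ m ∧ p + m ≤ k + t ∧ ∃ r, m = t + 2 * r := by
    by_cases h : k - p ≤ m
    · exact ⟨m - (k - p), by omega, by omega, by omega, q, by omega⟩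
    · exact ⟨m % 2, by omega, by omega, by omega, m / 2, by omega⟩
  refine ⟨fun i => if (i : ℕ) < t then i else i + 2 * r, fun i j hij => ?_, fun i => ?_,
    fun i => ?_, ⟨t, by omega⟩, ?_⟩
  · have : (i : ℕ) < j := hij
    dsimp only
    split_ifs <;> omega
  · have := i.isLt
    dsimp only
    split_ifs <;> omega
  · dsimp only
    split_ifs
    · exact ⟨i, rfl⟩
    · exact ⟨i + r, by ring⟩
  · simp [hr]

theorem exists_alternating_subsequence {n : ℕ} {σ : Fin (n + 1) → ℝ}
    (hσ : ∀ i, σ i = 1 ∨ σ i = -1) {p : ℕ} (hp : 0 < p)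
    (hpk : p ≤ variationsBefore σ (Fin.last n))
    (hparity : Even (variationsBefore σ (Fin.last n) - p)) (j : Fin (n + 1)) :
    ∃ c : Fin (p + 1) → Fin (n + 1), StrictMono c ∧
      (∀ i, σ (c i) = (-1) ^ (p + (i : ℕ)) * ((-1) ^ p * σ 0)) ∧ ∃ i, c i = j := by
  obtain ⟨d, hd, hdk, hdpar, t, ht⟩ := exists_alternating_selection hp hpk hparity
    (variationsBefore_mono σ (Fin.le_last j))
  have hex : ∀ i, ∃ l, variationsBefore σ l = d i ∧ (i = t → l = j) := fun i => by
    by_cases h : i = t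
    · exact ⟨j, by rw [h, ht], fun _ => rfl⟩
    · obtain ⟨l, hl⟩ := exists_variationsBefore_eq σ _ (hdk i)
      exact ⟨l, hl, fun h' => absurd h' h⟩
  choose c hc hct using hex
  refine ⟨c, fun i l hil => ?_, fun i => ?_, t, hct t rfl⟩
  · by_contra! hle
    have := variationsBefore_mono σ hle
    rw [hc, hc] at this
    exact absurd (hd hil) (not_lt.2 this)
  · rw [sign_eq_neg_one_pow_variationsBefore hσ (c i), hc, ← mul_assoc, ← pow_add]
    congr 1
    have := hdpar i
    rw [neg_one_pow_eq_pow_mod_two, neg_one_pow_eq_pow_mod_two (n := p + i + p)]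
    congr 1
    rw [Nat.even_iff] at this
    omega

theorem sign_eq_of_mul_pos {s a : ℝ} (hs : s = 1 ∨ s = -1) (h : 0 < s * a) :
    a ≠ 0 ∧ Real.sign a = s := by
  rcases hs with rfl | rfl
  · rw [one_mul] at h
    exact ⟨h.ne', Real.sign_of_pos h⟩
  · have ha : a < 0 := by linarith
    exact ⟨ha.ne, Real.sign_of_neg ha⟩

/-- With equal extreme signs, a polynomial with the prescribed signs can be made free of positive
roots by giving its extreme coefficients enough weight. -/
theorem exists_coeffs_no_pos_root {n : ℕ} {α : Fin (n + 1) → ℕ} (hα : StrictMono α)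
    {σ : Fin (n + 1) → ℝ} (hσ : ∀ i, σ i = 1 ∨ σ i = -1) (hends : σ (Fin.last n) = σ 0) :
    ∃ a : Fin (n + 1) → ℝ, (∀ i, 0 < σ i * a i) ∧
      ∀ x : ℝ, 0 < x → (∑ i, C (a i) * X ^ α i).eval x ≠ 0 := by
  classical
  have hsq : ∀ i, σ i * σ i = 1 := fun i => by rcases hσ i with h | h <;> simp [h]
  let w : Fin (n + 1) → ℝ := fun i =>
    1 + (if i = 0 then (n + 2 : ℝ) else 0) + if i = Fin.last n then (n + 2 : ℝ) else 0
  have hw : ∀ i, 0 < w i := fun i => by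
    simp only [w]
    split_ifs <;> positivity
  refine ⟨fun i => σ i * w i, fun i => by rw [← mul_assoc, hsq, one_mul]; exact hw i, ?_⟩
  intro x hx h0
  have hbound : ∀ i, x ^ α i ≤ x ^ α 0 + x ^ α (Fin.last n) := fun i => by
    rcases le_total x 1 with h | h
    · have := pow_le_pow_of_le_one hx.le h (hα.monotone (Fin.zero_le i))
      have := pow_pos hx (α (Fin.last n))
      linarith
    · have := pow_le_pow_right₀ h (hα.monotone (Fin.le_last i))
      have := pow_pos hx (α 0)
      linarith
  have heval : σ 0 * (∑ i, C (σ i * w i) * X ^ α i).eval x =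
      ∑ i, σ 0 * σ i * x ^ α i + (n + 2) * (x ^ α 0 + x ^ α (Fin.last n)) := by
    have h1 : ∀ i, σ 0 * (σ i * w i * x ^ α i) = σ 0 * σ i * x ^ α i +
        (if i = 0 then (n + 2) * (σ 0 * σ i) * x ^ α i else 0) +
        if i = Fin.last n then (n + 2) * (σ 0 * σ i) * x ^ α i else 0 := fun i => by
      simp only [w]
      split_ifs <;> ring
    simp only [eval_finsetSum, eval_mul, eval_C, eval_pow, eval_X, Finset.mul_sum, h1,
      Finset.sum_add_distrib, Finset.sum_ite_eq', Finset.mem_univ, if_true, hends, hsq]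
    ring
  have hlow : -((n + 1 : ℝ) * (x ^ α 0 + x ^ α (Fin.last n))) ≤
      ∑ i, σ 0 * σ i * x ^ α i := by
    have := Finset.sum_le_sum fun (i : Fin (n + 1)) (_ : i ∈ Finset.univ) =>
      show -(x ^ α 0 + x ^ α (Fin.last n)) ≤ σ 0 * σ i * x ^ α i by
        have := hbound i
        have := pow_pos hx (α i)
        rcases hσ 0 with h | h <;> rcases hσ i with h' | h' <;> rw [h, h'] <;> linarith
    rw [Finset.sum_const, Finset.card_univ, Fintype.card_fin, nsmul_eq_mul] at this
    push_cast at this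
    linarith
  rw [h0, mul_zero] at heval
  have := pow_pos hx (α 0)
  have := pow_pos hx (α (Fin.last n))
  linarith

/-- With at least one prescribed root, superposing polynomials supported on alternating
subsequences realises all prescribed signs. -/
theorem exists_coeffs_eq_prod_mul {n : ℕ} {α : Fin (n + 1) → ℕ} (hα : StrictMono α)
    {σ : Fin (n + 1) → ℝ} (hσ : ∀ i, σ i = 1 ∨ σ i = -1)
    {S : Multiset ℝ} (hS : ∀ x ∈ S, 0 < x) (hp : 0 < Multiset.card S)
    (hpk : Multiset.card S ≤ variationsBefore σ (Fin.last n))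
    (hparity : Even (variationsBefore σ (Fin.last n) - Multiset.card S)) :
    ∃ (a : Fin (n + 1) → ℝ) (g : ℝ[X]), (∀ i, 0 < σ i * a i) ∧
      ∑ i, C (a i) * X ^ α i = (S.map fun s => X - C s).prod * g ∧
      ∀ x : ℝ, 0 < x → g.eval x ≠ 0 := by
  classical
  choose c hc hσc t ht using exists_alternating_subsequence hσ hp hpk hparity
  choose b g hb hsum hg using fun j =>
    exists_alternating_coeffs (Multiset.card S) (fun i => α (c j i)) (hα.comp (hc j)) S hS rfl
  set τ : ℝ := (-1) ^ Multiset.card S * σ 0 with hτ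
  have hτsq : τ * τ = 1 := by
    rcases hσ 0 with h | h <;>
      rcases neg_one_pow_eq_or ℝ (Multiset.card S) with h' | h' <;> simp [hτ, h, h']
  have hpos : ∀ j l, 0 < σ (c j l) * (τ * b j l) := fun j l => by
    have := hb j l
    rw [hσc, show ∀ u : ℝ, u * τ * (τ * b j l) = τ * τ * (u * b j l) by intro u; ring, hτsq,
      one_mul]
    exact this
  refine ⟨fun i => ∑ j, ∑ l, if c j l = i then τ * b j l else 0, C τ * ∑ j, g j,
    fun i => ?_, ?_, fun x hx => ?_⟩
  · simp only [Finset.mul_sum]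
    have hnn : ∀ j l, 0 ≤ σ i * if c j l = i then τ * b j l else 0 := fun j l => by
      split_ifs with h
      · rw [← h]
        exact (hpos j l).le
      · rw [mul_zero]
    refine Finset.sum_pos' (fun j _ => Finset.sum_nonneg fun l _ => hnn j l)
      ⟨i, Finset.mem_univ i, Finset.sum_pos' (fun l _ => hnn i l) ⟨t i, Finset.mem_univ _, ?_⟩⟩
    have := hpos i (t i)
    rw [if_pos (ht i)]
    rwa [ht i] at this
  · calc ∑ i, C (∑ j, ∑ l, if c j l = i then τ * b j l else 0) * X ^ α i
        = ∑ i, ∑ j, ∑ l, if c j l = i then C (τ * b j l) * X ^ α i else 0 := by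
          simp only [map_sum, Finset.sum_mul, apply_ite C, C_0, ite_mul, zero_mul]
      _ = ∑ j, ∑ l, C (τ * b j l) * X ^ α (c j l) := by
          rw [Finset.sum_comm]
          refine Finset.sum_congr rfl fun j _ => ?_
          rw [Finset.sum_comm]
          simp
      _ = ∑ j, C τ * ((S.map fun s => X - C s).prod * g j) := by
          refine Finset.sum_congr rfl fun j _ => ?_
          rw [← hsum, Finset.mul_sum]
          simp only [C_mul, mul_assoc]
      _ = _ := by
          rw [← Finset.mul_sum, ← Finset.mul_sum]
          ring
  · rw [eval_mul, eval_C, eval_finsetSum]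
    refine mul_ne_zero (left_ne_zero_of_mul (hτsq ▸ one_ne_zero)) (ne_of_gt ?_)
    exact Finset.sum_pos (fun j _ => hg j x hx) Finset.univ_nonempty

/-- Converse of Descartes' rule of signs (Proposition 1, "if" part, polynomial case):
given exponents `α 0 < … < α n`, prescribed signs `σ i ∈ {1, -1}` with `k` sign
variations, and any multiset `S` of positive reals of cardinality `p` with `k - p`
even and nonnegative, there is a polynomial `∑ i, a i * X ^ (α i)` with
`sign (a i) = σ i` whose multiset of positive roots (with multiplicity) is `S`. -/
theorem descartes_rule_converse
    (n : ℕ) (α : Fin (n + 1) → ℕ) (hα : StrictMono α)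
    (σ : Fin (n + 1) → ℝ) (hσ : ∀ i, σ i = 1 ∨ σ i = -1)
    (k : ℕ)
    (hk : k = (Finset.univ.filter
      (fun i : Fin n => σ i.castSucc = -σ i.succ)).card)
    (S : Multiset ℝ) (hS : ∀ x ∈ S, 0 < x)
    (p : ℕ) (hp : Multiset.card S = p)
    (hpk : p ≤ k) (hparity : Even (k - p)) :
    ∃ a : Fin (n + 1) → ℝ,
      (∀ i, a i ≠ 0) ∧
      (∀ i, Real.sign (a i) = σ i) ∧
      ((∑ i : Fin (n + 1), C (a i) * X ^ (α i)).roots.filter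
        (fun x => 0 < x)) = S := by
  have hkv : k = variationsBefore σ (Fin.last n) := by
    rw [hk, variationsBefore, Nat.card_eq_fintype_card, Fintype.card_subtype]
    simp only [Fin.castSucc_lt_last, true_and]
  subst hp
  rw [hkv] at hpk hparity
  obtain ⟨a, g, ha, hsum, hg⟩ : ∃ (a : Fin (n + 1) → ℝ) (g : ℝ[X]), (∀ i, 0 < σ i * a i) ∧
      ∑ i, C (a i) * X ^ α i = (S.map fun s => X - C s).prod * g ∧
      ∀ x : ℝ, 0 < x → g.eval x ≠ 0 := by
    rcases Nat.eq_zero_or_pos (Multiset.card S) with h0 | hpos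
    · obtain rfl := Multiset.card_eq_zero.1 h0
      have hends : σ (Fin.last n) = σ 0 := by
        rw [sign_eq_neg_one_pow_variationsBefore hσ (Fin.last n), Even.neg_one_pow
          (by simpa using hparity), one_mul]
      obtain ⟨a, ha, hroot⟩ := exists_coeffs_no_pos_root hα hσ hends
      exact ⟨a, _, ha, by simp, hroot⟩
    · exact exists_coeffs_eq_prod_mul hα hσ hS hpos hpk hparity
  refine ⟨a, fun i => (sign_eq_of_mul_pos (hσ i) (ha i)).1,
    fun i => (sign_eq_of_mul_pos (hσ i) (ha i)).2, ?_⟩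
  rw [hsum]
  exact roots_filter_pos_prod_mul hS hg
end

section
/- Let α₀ < α₁ < … < αₙ be real numbers, let σ₀, σ₁, …, σₙ ∈ {+1, −1} be prescribed signs, and let k be the number of indices i with σᵢ = −σᵢ₊₁. Let 0 < x₁ < x₂ < … < x_p be distinct positive real numbers with k − p even and nonnegative. Then there exist nonzero real numbers a₀, …, aₙ with sign(aᵢ) = σᵢ for all i such that the function Y(x) = a₀x^{α₀} + … + aₙx^{αₙ} (defined for x > 0 via real powers) satisfies: {x > 0 : Y(x) = 0} = {x₁, …, x_p}, and Y′(xⱼ) ≠ 0 for each j = 1, …, p. -/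
open Filter Topology Asymptotics

/-- The exponential sum `s ↦ ∑ i, b i * exp (α i * s)`. -/
noncomputable def expSum {ι : Type*} [Fintype ι] (α b : ι → ℝ) (s : ℝ) : ℝ :=
  ∑ i, b i * Real.exp (α i * s)

/-- Multiplying by `α i - α d` removes `d` from the support. -/
theorem mul_sub_eq_zero_of_notMem_erase {ι : Type*} [DecidableEq ι] {α b : ι → ℝ}
    {T : Finset ι} (hb : ∀ i, i ∉ T → b i = 0) (d : ι) :
    ∀ i, i ∉ T.erase d → b i * (α i - α d) = 0 := by
  intro i hi
  by_cases hid : i = d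
  · simp [hid]
  · rw [hb i fun h => hi (Finset.mem_erase.2 ⟨hid, h⟩), zero_mul]

section ExpSum

variable {ι : Type*} [Fintype ι] {α b : ι → ℝ}

theorem hasDerivAt_expSum (α b : ι → ℝ) (s : ℝ) :
    HasDerivAt (expSum α b) (expSum α (fun i => b i * α i) s) s := by
  unfold expSum
  refine HasDerivAt.fun_sum fun i _ => ?_
  exact ((((hasDerivAt_id' s).const_mul (α i)).exp).const_mul (b i)).congr_deriv (by ring)

theorem continuous_expSum (α b : ι → ℝ) : Continuous (expSum α b) := by
  unfold expSum
  fun_prop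

theorem expSum_mul_sub (α b : ι → ℝ) (d s : ℝ) :
    expSum α (fun i => b i * (α i - d)) s =
      expSum α (fun i => b i * α i) s - d * expSum α b s := by
  simp only [expSum, Finset.mul_sum, ← Finset.sum_sub_distrib]
  exact Finset.sum_congr rfl fun i _ => by ring

theorem expSum_add_mul (α c z : ι → ℝ) (ε s : ℝ) :
    expSum α (fun i => c i + ε * z i) s = expSum α c s + ε * expSum α z s := by
  simp only [expSum, Finset.mul_sum, ← Finset.sum_add_distrib]
  exact Finset.sum_congr rfl fun i _ => by ring

theorem expSum_eq_single {i : ι} (h : ∀ j, j ≠ i → b j = 0) (s : ℝ) :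
    expSum α b s = b i * Real.exp (α i * s) :=
  Fintype.sum_eq_single i fun j hj => by rw [h j hj, zero_mul]

/-- Rolle's theorem for `exp (-d * s) * expSum α b s`. -/
theorem exists_expSum_mul_sub_eq_zero (d : ℝ) {u v : ℝ} (huv : u < v)
    (hu : expSum α b u = 0) (hv : expSum α b v = 0) :
    ∃ w, u < w ∧ w < v ∧ expSum α (fun i => b i * (α i - d)) w = 0 := by
  have hd (s : ℝ) : HasDerivAt (fun s => Real.exp (-d * s) * expSum α b s)
      (Real.exp (-d * s) * expSum α (fun i => b i * (α i - d)) s) s := by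
    refine ((((hasDerivAt_id' s).const_mul (-d)).exp).mul
      (hasDerivAt_expSum α b s)).congr_deriv ?_
    rw [expSum_mul_sub]
    ring
  obtain ⟨w, hw, h⟩ := exists_hasDerivAt_eq_zero huv
    (fun s _ => (hd s).continuousAt.continuousWithinAt) (by simp [hu, hv]) fun s _ => hd s
  exact ⟨w, hw.1, hw.2, (mul_eq_zero.1 h).resolve_left (Real.exp_ne_zero _)⟩

theorem exists_finset_expSum_mul_sub_eq_zero (d : ℝ) (R : Finset ℝ)
    (hR : ∀ r ∈ R, expSum α b r = 0) :
    ∃ R' : Finset ℝ, R.card ≤ R'.card + 1 ∧ Disjoint R' R ∧ (∀ w ∈ R', ∃ r ∈ R, w < r) ∧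
      ∀ w ∈ R', expSum α (fun i => b i * (α i - d)) w = 0 := by
  induction R using Finset.induction_on_max with
  | empty => exact ⟨∅, by simp⟩
  | insert v R hv ih =>
    obtain ⟨R', hcard, hdisj, hlt, hz⟩ := ih fun r hr => hR r (Finset.mem_insert_of_mem hr)
    have hvR : v ∉ R := fun h => lt_irrefl _ (hv v h)
    rcases R.eq_empty_or_nonempty with rfl | hne
    · exact ⟨∅, by simp⟩
    obtain ⟨w, hw1, hw2, hw⟩ := exists_expSum_mul_sub_eq_zero d (hv _ (R.max'_mem hne))
      (hR _ (Finset.mem_insert_of_mem (R.max'_mem hne))) (hR v (Finset.mem_insert_self _ _))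
    have hwR' : w ∉ R' := fun h => by
      obtain ⟨r, hr, hwr⟩ := hlt w h
      exact absurd (R.le_max' r hr) (by linarith)
    have hwR : w ∉ R := fun h => absurd (R.le_max' w h) (not_le.2 hw1)
    refine ⟨insert w R', ?_, ?_, ?_, ?_⟩
    · rw [Finset.card_insert_of_notMem hwR', Finset.card_insert_of_notMem hvR]
      omega
    · rw [Finset.disjoint_insert_left, Finset.disjoint_insert_right]
      refine ⟨?_, fun h => ?_, hdisj⟩
      · simp [hw2.ne, hwR]
      · obtain ⟨r, hr, hvr⟩ := hlt v h
        exact lt_asymm hvr (hv r hr)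
    · intro y hy
      rcases Finset.mem_insert.1 hy with rfl | hy
      · exact ⟨v, Finset.mem_insert_self _ _, hw2⟩
      · obtain ⟨r, hr, h⟩ := hlt y hy
        exact ⟨r, Finset.mem_insert_of_mem hr, h⟩
    · intro y hy
      rcases Finset.mem_insert.1 hy with rfl | hy
      exacts [hw, hz y hy]

/-- An exponential sum with at least as many zeros as terms vanishes identically. -/
theorem eq_zero_of_expSum_eq_zero (hα : Function.Injective α) (T : Finset ι)
    (hb : ∀ i, i ∉ T → b i = 0) (R : Finset ℝ) (hTR : T.card ≤ R.card)
    (hR : ∀ r ∈ R, expSum α b r = 0) (i : ι) : b i = 0 := by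
  classical
  induction hm : T.card generalizing T R b i with
  | zero =>
    rw [Finset.card_eq_zero] at hm
    exact hb i (by simp [hm])
  | succ m ih =>
    by_cases hiT : i ∈ T
    swap
    · exact hb i hiT
    by_cases h : ∃ d ∈ T, d ≠ i
    · obtain ⟨d, hd, hdi⟩ := h
      obtain ⟨R', hcard, -, -, hz⟩ := exists_finset_expSum_mul_sub_eq_zero (α d) R hR
      have hc := Finset.card_erase_of_mem hd
      have := ih (T.erase d) (mul_sub_eq_zero_of_notMem_erase hb d) R' (by omega) hz i (by omega)
      exact (mul_eq_zero.1 this).resolve_right (sub_ne_zero.2 fun h => hdi (hα h).symm)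
    · push Not at h
      obtain ⟨r, hr⟩ := Finset.card_pos.1 (by omega : 0 < R.card)
      have := hR r hr
      rw [expSum_eq_single (i := i) fun j hj => hb j fun hjT => hj (h j hjT)] at this
      exact (mul_eq_zero.1 this).resolve_right (Real.exp_ne_zero _)

/-- An exponential sum with one more term than zeros has coefficients of alternating signs. -/
theorem mul_neg_of_expSum_eq_zero [LinearOrder ι] (hα : StrictMono α) (T : Finset ι)
    (hb : ∀ i, i ∉ T → b i = 0) (R : Finset ℝ) (hTR : T.card ≤ R.card + 1)
    (hR : ∀ r ∈ R, expSum α b r = 0) {i j : ι} (hi : i ∈ T) (hj : j ∈ T) (hij : i < j)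
    (hadj : ∀ l ∈ T, l ≤ i ∨ j ≤ l) (hbi : b i ≠ 0) : b i * b j < 0 := by
  induction hm : T.card generalizing T R b with
  | zero =>
    rw [Finset.card_eq_zero] at hm
    simp [hm] at hi
  | succ m ih =>
    by_cases h : ∃ d ∈ T, d ≠ i ∧ d ≠ j
    · obtain ⟨d, hd, hdi, hdj⟩ := h
      obtain ⟨R', hcard, -, -, hz⟩ := exists_finset_expSum_mul_sub_eq_zero (α d) R hR
      have hc := Finset.card_erase_of_mem hd
      have key := ih (T.erase d) (mul_sub_eq_zero_of_notMem_erase hb d) R' (by omega) hz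
        (Finset.mem_erase.2 ⟨hdi.symm, hi⟩) (Finset.mem_erase.2 ⟨hdj.symm, hj⟩)
        (fun l hl => hadj l (Finset.mem_of_mem_erase hl))
        (mul_ne_zero hbi (sub_ne_zero.2 fun h => hdi (hα.injective h).symm)) (by omega)
      have hpos : 0 < (α i - α d) * (α j - α d) := by
        rcases hadj d hd with h | h
        · have h1 := hα (lt_of_le_of_ne h hdi)
          have h2 := hα hij
          exact mul_pos (by linarith) (by linarith)
        · have h1 := hα (lt_of_le_of_ne h hdj.symm)
          have h2 := hα hij
          exact mul_pos_of_neg_of_neg (by linarith) (by linarith)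
      by_contra! hle
      nlinarith [mul_nonneg hle hpos.le]
    · push Not at h
      have hT : 1 < T.card := Finset.one_lt_card.2 ⟨i, hi, j, hj, hij.ne⟩
      obtain ⟨r, hr⟩ := Finset.card_pos.1 (by omega : 0 < R.card)
      have hsum := hR r hr
      have : expSum α b r = b i * Real.exp (α i * r) + b j * Real.exp (α j * r) :=
        Fintype.sum_eq_add i j hij.ne fun l hl => by
          rw [hb l fun hlT => hl.2 (h l hlT hl.1), zero_mul]
      rw [this] at hsum
      have hbj : b j * Real.exp (α j * r) = -(b i * Real.exp (α i * r)) := by linarith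
      have h1 : b i * b j * Real.exp (α j * r) = -(b i ^ 2 * Real.exp (α i * r)) := by
        rw [mul_assoc, hbj]; ring
      have h2 : b i * b j * Real.exp (α j * r) < 0 := by
        rw [h1, neg_lt_zero]; positivity
      by_contra! hle
      linarith [mul_nonneg hle (Real.exp_pos (α j * r)).le]

/-- An exponential sum with one more term than zeros has only simple zeros. -/
theorem expSum_deriv_ne_zero (hα : Function.Injective α) (T : Finset ι)
    (hb : ∀ i, i ∉ T → b i = 0) (R : Finset ℝ) (hTR : T.card ≤ R.card + 1)
    (hR : ∀ r ∈ R, expSum α b r = 0) {i : ι} (hbi : b i ≠ 0) {r : ℝ} (hr : r ∈ R) :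
    expSum α (fun i => b i * α i) r ≠ 0 := by
  classical
  intro h0
  have hiT : i ∈ T := by_contra fun h => hbi (hb i h)
  by_cases h : ∃ d ∈ T, d ≠ i
  · obtain ⟨d, hd, hdi⟩ := h
    obtain ⟨R', hcard, hdisj, -, hz⟩ := exists_finset_expSum_mul_sub_eq_zero (α d) R hR
    have hrR' : r ∉ R' := fun h => Finset.disjoint_left.1 hdisj h hr
    have hc := Finset.card_erase_of_mem hd
    have := eq_zero_of_expSum_eq_zero hα (T.erase d) (mul_sub_eq_zero_of_notMem_erase hb d)
      (insert r R') (by rw [Finset.card_insert_of_notMem hrR']; omega) (by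
        intro w hw
        rcases Finset.mem_insert.1 hw with rfl | hw
        · rw [expSum_mul_sub, h0, hR _ hr]; ring
        · exact hz w hw) i
    exact mul_ne_zero hbi (sub_ne_zero.2 fun h => hdi (hα h).symm) this
  · push Not at h
    have := hR r hr
    rw [expSum_eq_single (i := i) fun j hj => hb j fun hjT => hj (h j hjT)] at this
    exact mul_ne_zero hbi (Real.exp_ne_zero _) this

/-- Any prescription of the coefficients off `T` extends to an exponential sum vanishing on `R`,
provided `T` has as many elements as `R`. -/
theorem exists_expSum_eq_zero (hα : Function.Injective α) (T : Finset ι) (R : Finset ℝ)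
    (hTR : T.card = R.card) (v : ι → ℝ) :
    ∃ u : ι → ℝ, (∀ i, i ∉ T → u i = v i) ∧ ∀ r ∈ R, expSum α u r = 0 := by
  classical
  let extend (w : T → ℝ) (i : ι) : ℝ := if h : i ∈ T then w ⟨i, h⟩ else 0
  have hextend (w : T → ℝ) (i : ι) (hi : i ∉ T) : extend w i = 0 := dif_neg hi
  let L : (T → ℝ) →ₗ[ℝ] (R → ℝ) :=
    { toFun := fun w r => expSum α (extend w) r
      map_add' := fun w w' => by
        ext r
        simp only [expSum, Pi.add_apply, ← Finset.sum_add_distrib]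
        refine Finset.sum_congr rfl fun i _ => ?_
        by_cases h : i ∈ T <;> simp [extend, h]; ring
      map_smul' := fun a w => by
        ext r
        simp only [expSum, Pi.smul_apply, smul_eq_mul, RingHom.id_apply, Finset.mul_sum]
        refine Finset.sum_congr rfl fun i _ => ?_
        by_cases h : i ∈ T <;> simp [extend, h]; ring }
  have hinj : Function.Injective L := by
    rw [injective_iff_map_eq_zero]
    intro w hw
    ext i
    have := eq_zero_of_expSum_eq_zero hα T (hextend w) R hTR.le
      (fun r hr => congrFun hw ⟨r, hr⟩) i
    simpa [extend] using this
  have hsurj : Function.Surjective L :=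
    (LinearMap.injective_iff_surjective_of_finrank_eq_finrank (by simp [hTR])).1 hinj
  obtain ⟨w, hw⟩ := hsurj fun r => -expSum α (fun i => if i ∈ T then 0 else v i) r
  refine ⟨fun i => (if i ∈ T then 0 else v i) + 1 * extend w i, fun i hi => ?_, fun r hr => ?_⟩
  · simp [hi, hextend w i hi]
  · have : expSum α (extend w) r = _ := congrFun hw ⟨r, hr⟩
    rw [expSum_add_mul, this]
    ring

theorem tendsto_expSum_div_exp {l : Filter ℝ} {m : ι}
    (h : ∀ i, i ≠ m → Tendsto (fun s => (α i - α m) * s) l atBot) (b : ι → ℝ) :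
    Tendsto (fun s => expSum α b s / Real.exp (α m * s)) l (𝓝 (b m)) := by
  classical
  have heq : (fun s => expSum α b s / Real.exp (α m * s)) =
      fun s => ∑ i, b i * Real.exp ((α i - α m) * s) := by
    ext s
    rw [expSum, Finset.sum_div]
    refine Finset.sum_congr rfl fun i _ => ?_
    rw [mul_div_assoc, ← Real.exp_sub, sub_mul]
  have hsum : ∑ i, (if i = m then b m else 0) = b m := by simp
  rw [heq, ← hsum]
  refine tendsto_finsetSum _ fun i _ => ?_
  by_cases him : i = m
  · subst him
    simp [tendsto_const_nhds]
  · simpa [him] using (Real.tendsto_exp_atBot.comp (h i him)).const_mul (b i)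

theorem expSum_isBigO_of_dominant {l : Filter ℝ} {m : ι}
    (h : ∀ i, i ≠ m → Tendsto (fun s => (α i - α m) * s) l atBot) {c : ι → ℝ} (hc : c m ≠ 0)
    (z : ι → ℝ) : expSum α z =O[l] expSum α c := by
  have hz : expSum α z =O[l] fun s => Real.exp (α m * s) :=
    isBigO_of_div_tendsto_nhds (Eventually.of_forall fun s hs => absurd hs (Real.exp_ne_zero _))
      _ (tendsto_expSum_div_exp h z)
  exact hz.trans (isBigO_of_div_tendsto_nhds_of_ne_zero (tendsto_expSum_div_exp h c) hc)

/-- If all zeros of `expSum α c` are simple and are zeros of `expSum α z`, then the second sum is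
locally controlled by the first. -/
theorem expSum_isBigO_nhds {c z : ι → ℝ} {s : ℝ}
    (h : expSum α c s = 0 → expSum α z s = 0 ∧ expSum α (fun i => c i * α i) s ≠ 0) :
    expSum α z =O[𝓝 s] expSum α c := by
  by_cases hs : expSum α c s = 0
  · obtain ⟨hz, hd⟩ := h hs
    have h1 := (hasDerivAt_expSum α z s).isBigO_sub
    have h2 := (HasDerivAtFilter.isTheta_sub (hasDerivAt_expSum α c s) hd).isBigO_symm
    rw [prod_pure, isBigO_map] at h2
    simp only [hz, sub_zero] at h1
    simpa [Function.comp_def, hs] using h1.trans h2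
  · have h1 : expSum α z =O[𝓝 s] fun _ => (1 : ℝ) :=
      (continuous_expSum α z).continuousAt.isBigO_one ℝ
    have h2 : (fun _ => (1 : ℝ)) =O[𝓝 s] expSum α c :=
      isBigO_of_div_tendsto_nhds_of_ne_zero
        (by simpa using (continuous_expSum α c).tendsto s) hs
    exact h1.trans h2

theorem isBigO_principal_of_isCompact {f g : ℝ → ℝ} {K : Set ℝ} (hK : IsCompact K)
    (h : ∀ s ∈ K, f =O[𝓝 s] g) : f =O[𝓟 K] g := by
  refine hK.induction_on (p := fun K => f =O[𝓟 K] g) (by simp)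
    (fun s t hst ht => ht.mono (principal_mono.2 hst))
    (fun s t hs ht => by rw [← sup_principal]; exact hs.sup ht) fun s hs => ?_
  obtain ⟨C, hC⟩ := (h s hs).bound
  exact ⟨_, mem_nhdsWithin_of_mem_nhds hC, isBigO_principal.2 ⟨C, fun _ hx => hx⟩⟩

theorem isBigO_top_of_isBigO_nhds {f g : ℝ → ℝ} (hbot : f =O[atBot] g) (htop : f =O[atTop] g)
    (h : ∀ s, f =O[𝓝 s] g) : f =O[⊤] g := by
  have hcc : f =O[cocompact ℝ] g := by
    rw [cocompact_eq_atBot_atTop]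
    exact hbot.sup htop
  obtain ⟨C, hC⟩ := hcc.bound
  obtain ⟨K, hK, hKC⟩ := mem_cocompact.1 hC
  have h1 := isBigO_principal_of_isCompact hK fun s _ => h s
  have h2 : f =O[𝓟 Kᶜ] g := isBigO_principal.2 ⟨C, fun _ hx => hKC hx⟩
  simpa [sup_principal] using h1.sup h2

end ExpSum

theorem expSum_isBigO_top {n : ℕ} {α : Fin (n + 1) → ℝ} (hα : StrictMono α)
    {c z : Fin (n + 1) → ℝ} (h0 : c 0 ≠ 0) (hlast : c (Fin.last n) ≠ 0)
    (h : ∀ s, expSum α c s = 0 → expSum α z s = 0 ∧ expSum α (fun i => c i * α i) s ≠ 0) :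
    expSum α z =O[⊤] expSum α c := by
  refine isBigO_top_of_isBigO_nhds ?_ ?_ fun s => expSum_isBigO_nhds (h s)
  · refine expSum_isBigO_of_dominant (m := 0) (fun i hi => ?_) h0 z
    exact tendsto_id.const_mul_atBot (sub_pos.2 (hα (Fin.pos_iff_ne_zero.2 hi)))
  · refine expSum_isBigO_of_dominant (m := Fin.last n) (fun i hi => ?_) hlast z
    exact tendsto_id.const_mul_atTop_of_neg (sub_neg.2 (hα (Fin.lt_last_iff_ne_last.2 hi)))

/-- Filling in the missing signs of `c` by a small multiple of `z`, without changing the zeros. -/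
theorem exists_perturbation {n : ℕ} {α : Fin (n + 1) → ℝ} (hα : StrictMono α)
    {σ c z : Fin (n + 1) → ℝ} (R : Finset ℝ)
    (h0 : c 0 ≠ 0) (hlast : c (Fin.last n) ≠ 0)
    (hsign : ∀ i, 0 < c i * σ i ∨ (c i = 0 ∧ 0 < z i * σ i))
    (hc : ∀ s, expSum α c s = 0 ↔ s ∈ R)
    (hcd : ∀ s ∈ R, expSum α (fun i => c i * α i) s ≠ 0)
    (hz : ∀ s ∈ R, expSum α z s = 0) :
    ∃ a : Fin (n + 1) → ℝ, (∀ i, 0 < a i * σ i) ∧ (∀ s, expSum α a s = 0 ↔ s ∈ R) ∧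
      ∀ s ∈ R, expSum α (fun i => a i * α i) s ≠ 0 := by
  obtain ⟨C, hC⟩ := isBigO_top.1 (expSum_isBigO_top hα h0 hlast (z := z) fun s hs =>
    ⟨hz s ((hc s).1 hs), hcd s ((hc s).1 hs)⟩)
  have lim (u v : ℝ) : Tendsto (fun ε : ℝ => u + ε * v) (𝓝[>] 0) (𝓝 u) := by
    have : Tendsto (fun ε : ℝ => u + ε * v) (𝓝 0) (𝓝 (u + 0 * v)) :=
      (continuous_const.add (continuous_id.mul continuous_const)).tendsto 0
    simp only [zero_mul, add_zero] at this
    exact this.mono_left nhdsWithin_le_nhds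
  have e0 : ∀ᶠ ε : ℝ in 𝓝[>] 0, 0 < ε := self_mem_nhdsWithin
  have e1 : ∀ᶠ ε : ℝ in 𝓝[>] 0, ∀ i, 0 < (c i + ε * z i) * σ i := by
    refine eventually_all.2 fun i => ?_
    rcases hsign i with h | ⟨h, h'⟩
    · filter_upwards [(lim (c i * σ i) (z i * σ i)).eventually_const_lt h] with ε hε
      linarith
    · filter_upwards [e0] with ε hε
      rw [h, zero_add, mul_assoc]
      exact mul_pos hε h'
  have e2 : ∀ᶠ ε : ℝ in 𝓝[>] 0, ∀ s ∈ R,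
      expSum α (fun i => c i * α i) s + ε * expSum α (fun i => z i * α i) s ≠ 0 :=
    (Finset.eventually_all R).2 fun s hs => (lim _ _).eventually_ne (hcd s hs)
  have e3 : ∀ᶠ ε : ℝ in 𝓝[>] 0, 0 + ε * C < 1 := (lim 0 C).eventually_lt_const one_pos
  obtain ⟨ε, hε0, hε1, hε2, hε3⟩ := (e0.and (e1.and (e2.and e3))).exists
  refine ⟨fun i => c i + ε * z i, hε1, fun s => ?_, fun s hs => ?_⟩
  · rw [expSum_add_mul]
    refine ⟨fun h => (hc s).1 ?_, fun h => by rw [(hc s).2 h, hz s h]; ring⟩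
    by_contra hne
    have hpos : 0 < ‖expSum α c s‖ := norm_pos_iff.2 hne
    have heq : ‖expSum α c s‖ = ε * ‖expSum α z s‖ := by
      rw [eq_neg_of_add_eq_zero_left h, norm_neg, norm_mul, Real.norm_of_nonneg hε0.le]
    have := mul_le_mul_of_nonneg_left (hC s) hε0.le
    nlinarith
  · have : (fun i => (c i + ε * z i) * α i) = fun i => c i * α i + ε * (z i * α i) := by
      ext i; ring
    rw [this, expSum_add_mul]
    exact hε2 s hs

/-- The number of sign variations of `σ 0, …, σ n`. -/
noncomputable def signVar (σ : ℕ → ℝ) (n : ℕ) : ℕ :=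
  ∑ i ∈ Finset.range n, if σ i = -σ (i + 1) then 1 else 0

theorem signVar_succ (σ : ℕ → ℝ) (n : ℕ) :
    signVar σ (n + 1) = signVar σ n + if σ n = -σ (n + 1) then 1 else 0 :=
  Finset.sum_range_succ _ _

theorem eq_neg_one_pow_signVar {σ : ℕ → ℝ} (hσ : ∀ i, σ i = 1 ∨ σ i = -1) (n : ℕ) :
    σ 0 = (-1) ^ signVar σ n * σ n := by
  induction n with
  | zero => simp [signVar]
  | succ n ih =>
    rw [signVar_succ, ih]
    split_ifs with h
    · rw [h]; ring
    · rcases hσ n with h1 | h1 <;> rcases hσ (n + 1) with h2 | h2 <;> simp_all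

/-- A subsequence of `σ 0, …, σ n` with `p` variations which contains both endpoints. -/
theorem exists_alternating_finset {σ : ℕ → ℝ} (hσ : ∀ i, σ i = 1 ∨ σ i = -1) {n p : ℕ}
    (hp : 0 < p) (hpk : p ≤ signVar σ n) (heven : Even (signVar σ n - p)) :
    ∃ S : Finset ℕ, 0 ∈ S ∧ n ∈ S ∧ (∀ i ∈ S, i ≤ n) ∧ S.card = p + 1 ∧
      ∀ i ∈ S, ∀ j ∈ S, i < j → (∀ l ∈ S, l ≤ i ∨ j ≤ l) → σ i = -σ j := by
  induction n generalizing p with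
  | zero =>
    simp [signVar] at hpk
    omega
  | succ n ih =>
    have hstep := signVar_succ σ n
    split_ifs at hstep with h
    · obtain rfl | hp1 : p = 1 ∨ 1 < p := by omega
      · refine ⟨{0, n + 1}, by simp, by simp, by simp, by simp, fun i hi j hj hij _ => ?_⟩
        have h0 : i = 0 ∧ j = n + 1 := by
          simp only [Finset.mem_insert, Finset.mem_singleton] at hi hj
          omega
        rw [h0.1, h0.2, eq_neg_one_pow_signVar hσ (n + 1)]
        have hodd : Odd (signVar σ (n + 1)) := by
          rw [Nat.even_sub hpk] at heven
          rw [← Nat.not_even_iff_odd, heven]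
          decide
        rw [hodd.neg_one_pow]
        ring
      · obtain ⟨S, h0, hn, hle, hcard, halt⟩ := ih (p := p - 1) (by omega) (by omega)
          (by rwa [show signVar σ n - (p - 1) = signVar σ (n + 1) - p by omega])
        refine ⟨insert (n + 1) S, by simp [h0], by simp, ?_, ?_, ?_⟩
        · intro i hi
          rcases Finset.mem_insert.1 hi with rfl | hi
          · exact le_rfl
          · exact (hle i hi).trans n.le_succ
        · rw [Finset.card_insert_of_notMem fun h => by have := hle _ h; omega, hcard]
          omega
        · intro i hi j hj hij hadj
          have hiS : i ∈ S := by
            rcases Finset.mem_insert.1 hi with rfl | hi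
            · rcases Finset.mem_insert.1 hj with rfl | hj
              · omega
              · have := hle j hj; omega
            · exact hi
          rcases Finset.mem_insert.1 hj with rfl | hj
          · have h1 := hadj n (Finset.mem_insert_of_mem hn)
            have h2 := hle i hiS
            obtain rfl : i = n := by omega
            exact h
          · exact halt i hiS j hj hij fun l hl => hadj l (Finset.mem_insert_of_mem hl)
    · have hσn : σ (n + 1) = σ n := by
        rcases hσ n with h1 | h1 <;> rcases hσ (n + 1) with h2 | h2 <;> simp_all
      obtain ⟨S, h0, hn, hle, hcard, halt⟩ := ih hp (by omega) (by rwa [hstep] at heven)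
      have hn0 : n ≠ 0 := by
        rintro rfl
        have : signVar σ 0 = 0 := Finset.sum_range_zero _
        omega
      have hmem (i : ℕ) : i ∈ insert (n + 1) (S.erase n) ↔ i = n + 1 ∨ (i ≠ n ∧ i ∈ S) := by
        simp
      refine ⟨insert (n + 1) (S.erase n), by simp [h0, hn0.symm], by simp, ?_, ?_, ?_⟩
      · intro i hi
        rcases (hmem i).1 hi with rfl | hi
        · exact le_rfl
        · exact (hle i hi.2).trans n.le_succ
      · rw [Finset.card_insert_of_notMem fun h => by
          have := hle _ (Finset.mem_of_mem_erase h); omega, Finset.card_erase_of_mem hn, hcard]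
        omega
      · intro i hi j hj hij hadj
        simp only [hmem] at hi hj hadj
        have hiS : i ≠ n ∧ i ∈ S := by
          refine hi.resolve_left ?_
          rintro rfl
          rcases hj with rfl | hj
          · omega
          · have := hle j hj.2; omega
        have hin := hle i hiS.2
        rcases hj with rfl | hj
        · rw [hσn]
          refine halt i hiS.2 n hn (by omega) fun l hl => ?_
          by_cases hln : l = n
          · exact Or.inr hln.ge
          · rcases hadj l (Or.inr ⟨hln, hl⟩) with h | h <;> omega
        · refine halt i hiS.2 j hj.2 hij fun l hl => ?_
          by_cases hln : l = n
          · exact Or.inr (hln ▸ hle j hj.2)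
          · exact hadj l (Or.inr ⟨hln, hl⟩)

/-- An exponential sum whose terms off `T` vanish, with prescribed simple zeros `R` and the
alternating signs `σ`. -/
theorem exists_expSum_alternating {n : ℕ} {α σ : Fin (n + 1) → ℝ} (hα : StrictMono α)
    (hσ : ∀ i, σ i ≠ 0) (R : Finset ℝ) (T : Finset (Fin (n + 1))) (hlast : Fin.last n ∈ T)
    (hcard : T.card = R.card + 1)
    (halt : ∀ i ∈ T, ∀ j ∈ T, i < j → (∀ l ∈ T, l ≤ i ∨ j ≤ l) → σ i = -σ j) :
    ∃ c : Fin (n + 1) → ℝ, (∀ i, i ∉ T → c i = 0) ∧ (∀ i ∈ T, 0 < c i * σ i) ∧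
      (∀ s, expSum α c s = 0 ↔ s ∈ R) ∧ ∀ s ∈ R, expSum α (fun i => c i * α i) s ≠ 0 := by
  obtain ⟨c, hc, hcR⟩ := exists_expSum_eq_zero hα.injective (T.erase (Fin.last n)) R
    (by rw [Finset.card_erase_of_mem hlast, hcard]; rfl)
    (Pi.single (Fin.last n) (σ (Fin.last n)))
  have hcl : c (Fin.last n) = σ (Fin.last n) := by
    rw [hc _ (Finset.notMem_erase _ _), Pi.single_eq_same]
  have hcT (i) (hi : i ∉ T) : c i = 0 := by
    rw [hc i fun h => hi (Finset.mem_of_mem_erase h),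
      Pi.single_eq_of_ne fun h => hi (by rwa [h])]
  have hcl0 : c (Fin.last n) ≠ 0 := hcl ▸ hσ _
  have hne (i) (hi : i ∈ T) : c i ≠ 0 := by
    intro h0
    refine hcl0 (eq_zero_of_expSum_eq_zero hα.injective (T.erase i) (fun j hj => ?_) R
      (by rw [Finset.card_erase_of_mem hi, hcard]; rfl) hcR _)
    by_cases hji : j = i
    · rw [hji, h0]
    · exact hcT j fun h => hj (Finset.mem_erase.2 ⟨hji, h⟩)
  refine ⟨c, hcT, fun i hi => ?_, fun s => ⟨fun hs => ?_, hcR s⟩, fun s hs =>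
    expSum_deriv_ne_zero hα.injective T hcT R hcard.le hcR hcl0 hs⟩
  · induction i using WellFoundedGT.induction with
    | ind i ih =>
      by_cases hil : i = Fin.last n
      · rw [hil, hcl]
        exact mul_self_pos.2 (hσ _)
      have hne' : (T.filter (i < ·)).Nonempty :=
        ⟨Fin.last n, Finset.mem_filter.2 ⟨hlast, Fin.lt_last_iff_ne_last.2 hil⟩⟩
      obtain ⟨hjT, hij⟩ := Finset.mem_filter.1 (Finset.min'_mem _ hne')
      set j := (T.filter (i < ·)).min' hne'
      have hadj (l) (hl : l ∈ T) : l ≤ i ∨ j ≤ l := by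
        rcases le_or_gt l i with h | h
        · exact Or.inl h
        · exact Or.inr (Finset.min'_le _ _ (Finset.mem_filter.2 ⟨hl, h⟩))
      have h1 := mul_neg_of_expSum_eq_zero hα T hcT R hcard.le hcR hi hjT hij hadj (hne i hi)
      have h2 := ih j hij hjT
      rw [halt i hi j hjT hij hadj]
      have h3 : (c i * -σ j) * c j ^ 2 = -(c i * c j) * (c j * σ j) := by ring
      exact pos_of_mul_pos_left (h3 ▸ mul_pos (neg_pos.2 h1) h2) (sq_nonneg _)
  · by_contra hsR
    refine hcl0 (eq_zero_of_expSum_eq_zero hα.injective T hcT (insert s R)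
      (by rw [Finset.card_insert_of_notMem hsR, hcard]) (fun r hr => ?_) _)
    rcases Finset.mem_insert.1 hr with rfl | hr
    exacts [hs, hcR r hr]

theorem exists_expSum_prescribed {n : ℕ} {α : Fin (n + 1) → ℝ} (hα : StrictMono α)
    {σ : ℕ → ℝ} (hσ : ∀ i, σ i = 1 ∨ σ i = -1) (R : Finset ℝ)
    (hR : R.card ≤ signVar σ n) (heven : Even (signVar σ n - R.card)) :
    ∃ a : Fin (n + 1) → ℝ, (∀ i : Fin (n + 1), 0 < a i * σ i) ∧
      (∀ s, expSum α a s = 0 ↔ s ∈ R) ∧ ∀ s ∈ R, expSum α (fun i => a i * α i) s ≠ 0 := by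
  have hσ0 (i) : σ i ≠ 0 := by rcases hσ i with h | h <;> rw [h] <;> norm_num
  rcases R.eq_empty_or_nonempty with rfl | hne
  · have hl : σ n = σ 0 := by
      rw [eq_neg_one_pow_signVar hσ n, Even.neg_one_pow (by simpa using heven), one_mul]
    let c : Fin (n + 1) → ℝ := fun i => if i = 0 ∨ i = Fin.last n then σ 0 else 0
    refine exists_perturbation hα (σ := fun i => σ i) (c := c) (z := fun i => σ i) ∅
      (by simp [c, hσ0]) (by simp [c, hσ0]) (fun i => ?_) (fun s => ?_) (by simp) (by simp)
    · by_cases hi : i = 0 ∨ i = Fin.last n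
      · left
        rcases hi with rfl | rfl
        · simpa [c] using hσ0 0
        · simpa [c, hl] using hσ0 0
      · exact Or.inr ⟨if_neg hi, mul_self_pos.2 (hσ0 _)⟩
    · simp only [Finset.notMem_empty, iff_false]
      have : expSum α c s =
          σ 0 * ∑ i, if i = 0 ∨ i = Fin.last n then Real.exp (α i * s) else 0 := by
        rw [expSum, Finset.mul_sum]
        exact Finset.sum_congr rfl fun i _ => by simp only [c]; split_ifs <;> simp
      rw [this]
      refine mul_ne_zero (hσ0 0) (ne_of_gt ?_)
      exact Finset.sum_pos' (fun i _ => by split_ifs <;> positivity)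
        ⟨0, Finset.mem_univ _, by simp [Real.exp_pos]⟩
  · obtain ⟨S, h0, hn, hle, hcard, halt⟩ :=
      exists_alternating_finset hσ (Finset.card_pos.2 hne) hR heven
    have hlt (i) (hi : i ∈ S) : i < n + 1 := Nat.lt_succ_of_le (hle i hi)
    let T := S.attachFin hlt
    have hT (i : Fin (n + 1)) : i ∈ T ↔ (i : ℕ) ∈ S := Finset.mem_attachFin _
    have hTcard : T.card = R.card + 1 := by rw [Finset.card_attachFin, hcard]
    have hlast : Fin.last n ∈ T := (hT _).2 hn
    obtain ⟨c, hcT, hcσ, hcR, hcd⟩ := exists_expSum_alternating hα (σ := fun i => σ i)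
      (fun i => hσ0 i) R T hlast hTcard fun i hi j hj hij hadj =>
        halt i ((hT i).1 hi) j ((hT j).1 hj) hij fun l hl =>
          hadj ⟨l, hlt l hl⟩ ((hT _).2 hl)
    obtain ⟨z, hz, hzR⟩ := exists_expSum_eq_zero hα.injective (T.erase (Fin.last n)) R
      (by rw [Finset.card_erase_of_mem hlast, hTcard]; rfl) fun i => σ i
    refine exists_perturbation hα (σ := fun i => σ i) (c := c) (z := z) R
      (left_ne_zero_of_mul (hcσ 0 ((hT 0).2 h0)).ne')
      (left_ne_zero_of_mul (hcσ _ hlast).ne') (fun i => ?_) hcR hcd hzR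
    by_cases hi : i ∈ T
    · exact Or.inl (hcσ i hi)
    · refine Or.inr ⟨hcT i hi, ?_⟩
      rw [hz i fun h => hi (Finset.mem_of_mem_erase h)]
      exact mul_self_pos.2 (hσ0 _)

theorem sum_mul_rpow_eq_expSum_log {ι : Type*} [Fintype ι] (α a : ι → ℝ) {t : ℝ} (ht : 0 < t) :
    ∑ i, a i * t ^ α i = expSum α a (Real.log t) :=
  Finset.sum_congr rfl fun i _ => by rw [Real.rpow_def_of_pos ht, mul_comm (Real.log t)]

/-- Converse of Descartes' rule for real exponents with simple roots:
given real exponents `α 0 < … < α n`, prescribed signs `σ i ∈ {1, -1}` with `k`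
sign variations, and `0 < x 1 < … < x p` with `k - p` even and nonnegative,
there are coefficients `a i` with `sign (a i) = σ i` such that
`Y t = ∑ i, a i * t ^ (α i)` has the `x j` as its exact set of positive zeros,
each being a simple zero. -/
theorem descartes_rule_converse_real_exponents
    (n : ℕ) (α : Fin (n + 1) → ℝ) (hα : StrictMono α)
    (σ : Fin (n + 1) → ℝ) (hσ : ∀ i, σ i = 1 ∨ σ i = -1)
    (k : ℕ)
    (hk : k = (Finset.univ.filter
      (fun i : Fin n => σ i.castSucc = -σ i.succ)).card)
    (p : ℕ) (x : Fin p → ℝ) (hx : StrictMono x) (hxpos : ∀ j, 0 < x j)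
    (hpk : p ≤ k) (hparity : Even (k - p)) :
    ∃ a : Fin (n + 1) → ℝ,
      (∀ i, a i ≠ 0) ∧
      (∀ i, Real.sign (a i) = σ i) ∧
      {t : ℝ | 0 < t ∧ (∑ i : Fin (n + 1), a i * t ^ (α i)) = 0} = Set.range x ∧
      ∀ j, deriv (fun t : ℝ => ∑ i : Fin (n + 1), a i * t ^ (α i)) (x j) ≠ 0 := by
  let τ : ℕ → ℝ := fun m => σ (Fin.ofNat (n + 1) m)
  have hτ (i : Fin (n + 1)) : τ i = σ i := by simp [τ]
  have hkτ : k = signVar τ n := by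
    rw [hk, Finset.card_filter, signVar, ← Fin.sum_univ_eq_sum_range
      (fun i => if τ i = -τ (i + 1) then 1 else 0)]
    refine Finset.sum_congr rfl fun i _ => ?_
    rw [← hτ, ← hτ, Fin.val_castSucc, Fin.val_succ]
  have hlog : Function.Injective fun j => Real.log (x j) := fun i j h =>
    hx.injective (Real.log_injOn_pos (hxpos i) (hxpos j) h)
  have hcard : (Finset.univ.image fun j => Real.log (x j)).card = p := by
    rw [Finset.card_image_of_injective _ hlog, Finset.card_fin]
  obtain ⟨a, haσ, haR, had⟩ := exists_expSum_prescribed hα (σ := τ) (fun i => hσ _)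
    (Finset.univ.image fun j => Real.log (x j)) (by rw [hcard, ← hkτ]; exact hpk)
    (by rw [hcard, ← hkτ]; exact hparity)
  simp only [hτ] at haσ
  refine ⟨a, fun i => left_ne_zero_of_mul (haσ i).ne', fun i => ?_, ?_, fun j => ?_⟩
  · rcases hσ i with h | h
    · rw [h, Real.sign_of_pos (by simpa [h] using haσ i)]
    · rw [h, Real.sign_of_neg (by simpa [h] using haσ i)]
  · ext t
    simp only [Set.mem_ofPred_eq, Set.mem_range]
    constructor
    · rintro ⟨ht, h0⟩
      rw [sum_mul_rpow_eq_expSum_log α a ht, haR] at h0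
      obtain ⟨j, -, hj⟩ := Finset.mem_image.1 h0
      exact ⟨j, Real.log_injOn_pos (hxpos j) ht hj⟩
    · rintro ⟨j, rfl⟩
      refine ⟨hxpos j, ?_⟩
      rw [sum_mul_rpow_eq_expSum_log α a (hxpos j), haR]
      exact Finset.mem_image_of_mem _ (Finset.mem_univ j)
  · have hd := (hasDerivAt_expSum α a (Real.log (x j))).comp (x j)
      (Real.hasDerivAt_log (hxpos j).ne')
    have heq : (fun t : ℝ => ∑ i, a i * t ^ α i) =ᶠ[𝓝 (x j)] expSum α a ∘ Real.log := by
      filter_upwards [lt_mem_nhds (hxpos j)] with t ht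
      exact sum_mul_rpow_eq_expSum_log α a ht
    rw [heq.deriv_eq, hd.deriv]
    exact mul_ne_zero (had _ (Finset.mem_image_of_mem _ (Finset.mem_univ j)))
      (inv_ne_zero (hxpos j).ne')
end
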